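/- Let G be a finite simple graph, let s be a vertex, and let e = {v,w} be an edge of G with edist_G(s,v) finite and edist_G(s,w) = edist_G(s,v) + 1. Then Σ_{t ∈ V, t ≠ s, σ_G(s,t) > 0} σ_G(s,t|e)/σ_G(s,t) = (σ_G(s,v) / σ_G(s,w)) · (1 + δ_s(w)). -/

import Mathlib

open SimpleGraph

/-- The number of shortest paths from `x` to `y` in `G`: walks whose length equals the
extended distance `G.edist x y`. -/
noncomputable def numSP {V : Type*} (G : SimpleGraph V) (x y : V) : ℕ :=
  Nat.card {p : G.Walk x y // (p.length : ℕ∞) = G.edist x y}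

/-- The number of shortest paths from `x` to `y` in `G` that contain `v` as an internal
vertex. -/
noncomputable def numSPviaV {V : Type*} (G : SimpleGraph V) (x y v : V) : ℕ :=
  Nat.card {p : G.Walk x y //
    (p.length : ℕ∞) = G.edist x y ∧ v ∈ p.support ∧ v ≠ x ∧ v ≠ y}

/-- The number of shortest paths from `x` to `y` in `G` that traverse the edge `e`. -/
noncomputable def numSPviaE {V : Type*} (G : SimpleGraph V) (x y : V) (e : Sym2 V) : ℕ :=
  Nat.card {p : G.Walk x y // (p.length : ℕ∞) = G.edist x y ∧ e ∈ p.edges}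

/-- The graph `G` with the edge `{a,b}` added. -/
def addEdge {V : Type*} (G : SimpleGraph V) (a b : V) : SimpleGraph V :=
  G ⊔ SimpleGraph.edge a b

open scoped Classical in
/-- The dependency of the source `s` on the vertex `v`:
`δ_s(v) = Σ_{t ∈ V, t ∉ {s,v}, σ(s,t) > 0} σ(s,t|v)/σ(s,t)`. -/
noncomputable def dep {V : Type*} (G : SimpleGraph V) [Fintype V] (s v : V) : ℚ :=
  ∑ t : V, if t ≠ s ∧ t ≠ v ∧ 0 < numSP G s t
    then (numSPviaV G s t v : ℚ) / (numSP G s t : ℚ) else 0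

namespace SimpleGraph.Walk

variable {V : Type*} {G : SimpleGraph V}

theorem append_inj_of_length_eq {x u y : V} {p p' : G.Walk x u} {q q' : G.Walk u y}
    (h : p.append q = p'.append q') (hl : p.length = p'.length) : p = p' ∧ q = q' := by
  induction p with
  | nil =>
    cases p' with
    | nil => exact ⟨rfl, by simpa using h⟩
    | cons _ _ => simp at hl
  | cons a p ih =>
    cases p' with
    | nil => simp at hl
    | cons b p' =>
      simp only [cons_append, cons.injEq] at h
      obtain ⟨rfl, h⟩ := h
      obtain ⟨rfl, rfl⟩ := ih (eq_of_heq h) (by simpa using hl)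
      exact ⟨rfl, rfl⟩

theorem exists_eq_append_cons_of_mem_edges {x y v w : V} (p : G.Walk x y)
    (h : s(v, w) ∈ p.edges) :
    (∃ (a : G.Walk x v) (e : G.Adj v w) (b : G.Walk w y), p = a.append (cons e b)) ∨
    (∃ (a : G.Walk x w) (e : G.Adj w v) (b : G.Walk v y), p = a.append (cons e b)) := by
  induction p with
  | nil => simp at h
  | cons e p ih =>
    rw [edges_cons, List.mem_cons] at h
    rcases h with h | h
    · rcases Sym2.eq_iff.mp h with ⟨rfl, rfl⟩ | ⟨rfl, rfl⟩
      · exact Or.inl ⟨nil, e, p, rfl⟩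
      · exact Or.inr ⟨nil, e, p, rfl⟩
    · rcases ih h with ⟨a, f, b, rfl⟩ | ⟨a, f, b, rfl⟩
      · exact Or.inl ⟨cons e a, f, b, rfl⟩
      · exact Or.inr ⟨cons e a, f, b, rfl⟩

theorem length_eq_edist_of_append {x u y : V} (a : G.Walk x u) (b : G.Walk u y)
    (h : ((a.append b).length : ℕ∞) = G.edist x y) : (a.length : ℕ∞) = G.edist x u := by
  refine le_antisymm ?_ (edist_le a)
  obtain ⟨c, hc⟩ := a.reachable.exists_walk_length_eq_edist
  have hle := edist_le (c.append b)
  rw [← h] at hle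
  rw [← hc]
  simp only [length_append, Nat.cast_le] at hle ⊢
  omega

end SimpleGraph.Walk

section Counting

variable {V : Type*} (G : SimpleGraph V)

/-- The number of walks from `w` to `t` that extend shortest paths from `s` to `w` to
shortest paths from `s` to `t`. -/
noncomputable def numExtensions (s w t : V) : ℕ :=
  Nat.card {q : G.Walk w t // G.edist s w + (q.length : ℕ∞) = G.edist s t}

theorem numSP_pos [Finite V] {s t : V} (h : G.Reachable s t) : 0 < numSP G s t := by
  classical
  have := Fintype.ofFinite V
  obtain ⟨c, hc⟩ := h.exists_walk_length_eq_edist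
  have : Finite {p : G.Walk s t // (p.length : ℕ∞) = G.edist s t} := by
    refine (Set.toFinite {p : G.Walk s t | p.length = c.length}).subset ?_
    intro p hp
    have hp : (p.length : ℕ∞) = G.edist s t := hp
    rw [← hc] at hp
    exact_mod_cast hp
  have : Nonempty {p : G.Walk s t // (p.length : ℕ∞) = G.edist s t} := ⟨⟨c, hc⟩⟩
  exact Nat.card_pos

theorem card_shortest_mem_support (s w t : V) :
    Nat.card {p : G.Walk s t // (p.length : ℕ∞) = G.edist s t ∧ w ∈ p.support}
      = numSP G s w * numExtensions G s w t := by
  classical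
  rw [numSP, numExtensions, ← Nat.card_prod]
  symm
  refine Nat.card_eq_of_bijective
    (fun z => ⟨z.1.1.append z.2.1, ?_, ?_⟩) ⟨?_, ?_⟩
  · rw [Walk.length_append, Nat.cast_add, z.1.2, z.2.2]
  · simp
  · rintro ⟨⟨p, hp⟩, q, hq⟩ ⟨⟨p', hp'⟩, q', hq'⟩ h
    obtain ⟨rfl, rfl⟩ := Walk.append_inj_of_length_eq (congrArg Subtype.val h)
      (by exact_mod_cast hp.trans hp'.symm)
    rfl
  · rintro ⟨r, hr, hwr⟩
    have hspec := r.take_spec hwr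
    have ha := Walk.length_eq_edist_of_append (r.takeUntil w hwr) (r.dropUntil w hwr)
      (by rw [hspec, hr])
    refine ⟨⟨⟨r.takeUntil w hwr, ha⟩, r.dropUntil w hwr, ?_⟩, Subtype.ext hspec⟩
    rw [← ha, ← hr, ← Nat.cast_add, ← Walk.length_append, hspec]

theorem numSPviaE_eq_mul {s v w : V} (hadj : G.Adj v w)
    (hw : G.edist s w = G.edist s v + 1) (t : V) :
    numSPviaE G s t s(v, w) = numSP G s v * numExtensions G s w t := by
  rw [numSP, numExtensions, numSPviaE, ← Nat.card_prod]
  symm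
  refine Nat.card_eq_of_bijective
    (fun z => ⟨z.1.1.append (Walk.cons hadj z.2.1), ?_, ?_⟩) ⟨?_, ?_⟩
  · obtain ⟨⟨p, hp⟩, q, hq⟩ := z
    dsimp only
    rw [← hq, Walk.length_append, Walk.length_cons, Nat.cast_add, Nat.cast_add, hp, hw,
      Nat.cast_one]
    ring
  · simp
  · rintro ⟨⟨p, hp⟩, q, hq⟩ ⟨⟨p', hp'⟩, q', hq'⟩ h
    obtain ⟨rfl, h⟩ := Walk.append_inj_of_length_eq (congrArg Subtype.val h)
      (by exact_mod_cast hp.trans hp'.symm)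
    simp only [Walk.cons.injEq, heq_eq_eq, true_and] at h
    subst h
    rfl
  · rintro ⟨r, hr, her⟩
    rcases r.exists_eq_append_cons_of_mem_edges her with ⟨a, e, b, rfl⟩ | ⟨a, e, b, rfl⟩
    · have ha := Walk.length_eq_edist_of_append _ _ hr
      refine ⟨⟨⟨a, ha⟩, b, ?_⟩, rfl⟩
      rw [hw, ← ha, ← hr, Walk.length_append, Walk.length_cons]
      push_cast
      ring
    · exfalso
      have ha := Walk.length_eq_edist_of_append _ _ hr
      rw [← Walk.concat_append] at hr
      have hc := Walk.length_eq_edist_of_append _ _ hr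
      rw [← ha, ← hc, Walk.length_concat] at hw
      have : a.length = a.length + 1 + 1 := by exact_mod_cast hw
      omega

theorem numSPviaE_mul_numSP {s v w : V} (hadj : G.Adj v w)
    (hw : G.edist s w = G.edist s v + 1) (t : V) :
    numSPviaE G s t s(v, w) * numSP G s w = numSP G s v *
      Nat.card {p : G.Walk s t // (p.length : ℕ∞) = G.edist s t ∧ w ∈ p.support} := by
  rw [numSPviaE_eq_mul G hadj hw, card_shortest_mem_support]
  ring

end Counting

open scoped Classical in
/-- For an edge `e = {v,w}` of `G` with `edist(s,v)` finite and
`edist(s,w) = edist(s,v) + 1`, the accumulated edge dependency satisfies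
`Σ_{t ≠ s, σ(s,t) > 0} σ(s,t|e)/σ(s,t) = (σ(s,v)/σ(s,w))·(1 + δ_s(w))`. -/
theorem stmt_12 {V : Type*} (G : SimpleGraph V) [Fintype V] (s v w : V)
    (hadj : G.Adj v w) (hfin : G.edist s v ≠ ⊤)
    (hw : G.edist s w = G.edist s v + 1) :
    ∑ t ∈ Finset.univ.filter (fun t => t ≠ s ∧ 0 < numSP G s t),
        (numSPviaE G s t s(v, w) : ℚ) / (numSP G s t : ℚ)
      = (numSP G s v : ℚ) / (numSP G s w : ℚ) * (1 + dep G s w) := by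
  have hsv : G.Reachable s v := edist_ne_top_iff_reachable.mp hfin
  have hpos : 0 < numSP G s w := numSP_pos G (hsv.trans hadj.reachable)
  have hne : (numSP G s w : ℚ) ≠ 0 := by exact_mod_cast hpos.ne'
  have hws : w ≠ s := by
    rintro rfl
    rw [edist_self] at hw
    exact absurd hw.symm (by simp)
  have key : ∀ t, (numSPviaE G s t s(v, w) : ℚ) = numSP G s v / numSP G s w *
      (Nat.card {p : G.Walk s t // (p.length : ℕ∞) = G.edist s t ∧ w ∈ p.support} : ℚ) := by
    intro t
    have := numSPviaE_mul_numSP G hadj hw t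
    field_simp
    exact_mod_cast this
  have hself : Nat.card {p : G.Walk s w // (p.length : ℕ∞) = G.edist s w ∧ w ∈ p.support}
      = numSP G s w := by
    simp [numSP]
  have hvia : ∀ t, t ≠ w →
      Nat.card {p : G.Walk s t // (p.length : ℕ∞) = G.edist s t ∧ w ∈ p.support}
        = numSPviaV G s t w := by
    intro t ht
    simp [numSPviaV, hws, ht.symm]
  rw [← Finset.add_sum_erase _ _ (Finset.mem_filter.mpr ⟨Finset.mem_univ w, hws, hpos⟩),
    mul_add, mul_one, dep, ← Finset.sum_filter, Finset.mul_sum]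
  congr 1
  · rw [key, hself]
    field_simp
  · refine Finset.sum_congr ?_ fun t ht => ?_
    · ext t
      simp only [Finset.mem_erase, Finset.mem_filter, Finset.mem_univ, true_and]
      tauto
    · rw [key, hvia t (Finset.mem_filter.mp ht).2.2.1, mul_div_assoc]
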